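/- arXiv:1002.1451 — 5 statements merged into one kernel-verified Lean document; each statement's English description precedes it below -/
import Mathlib

section
/- Let I be a finite poset containing elements i, j, k, s such that k ≠ s, k and s are incomparable, i ≺ k ≺ j and i ≺ s ≺ j (such a configuration arises whenever condition (F) fails). Then there exist matrices T, U ∈ 𝒯_l such that T∘(U∘Uᵀ) ≠ (T∘U)∘Uᵀ; that is, the Vinberg algebra axiom T(UUᵀ) = (TU)Uᵀ fails for the truncated product. -/
open Matrix
open scoped Classical

/-- `𝒯_l` : matrices that are lower triangular with respect to the poset `I`. -/
def IsTl {I : Type*} [Fintype I] [PartialOrder I] (A : Matrix I I ℝ) : Prop :=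
  ∀ j k, ¬ k ≤ j → A j k = 0

/-- The truncated (Vinberg) product of two matrices indexed by the poset `I`:
the `(i,j)` entry is the ordinary product entry when `i = j` or `i, j` are comparable,
and `0` when `i, j` are incomparable. -/
noncomputable def vprod {I : Type*} [Fintype I] [PartialOrder I]
    (A B : Matrix I I ℝ) : Matrix I I ℝ :=
  fun i j => if i = j ∨ i ≤ j ∨ j ≤ i then ∑ μ : I, A i μ * B μ j else 0

/-- If the poset `I` contains elements `i, j, k, s` with `k ≠ s`, `k` and `s`
incomparable, `i ≺ k ≺ j` and `i ≺ s ≺ j`, then the Vinberg axiom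
`T(UUᵀ) = (TU)Uᵀ` fails for the truncated product on lower triangular matrices. -/
theorem vinberg_axiom_fails_without_F
    {I : Type*} [Fintype I] [PartialOrder I] (i j k s : I)
    (hks : k ≠ s) (hinc : ¬ k ≤ s ∧ ¬ s ≤ k)
    (hik : i < k) (hkj : k < j) (his : i < s) (hsj : s < j) :
    ∃ T U : Matrix I I ℝ, IsTl T ∧ IsTl U ∧
      vprod T (vprod U Uᵀ) ≠ vprod (vprod T U) Uᵀ := by
  let T : Matrix I I ℝ := fun a b => if a = j ∧ b = k then 1 else 0
  let U : Matrix I I ℝ := fun a b => if (a = k ∨ a = s) ∧ b = i then 1 else 0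
  have hT : ∀ a b, T a b = if a = j ∧ b = k then 1 else 0 := fun _ _ => rfl
  have hU : ∀ a b, U a b = if (a = k ∨ a = s) ∧ b = i then 1 else 0 := fun _ _ => rfl
  refine ⟨T, U, ?_, ?_, fun h => ?_⟩
  · intro a b hab
    rw [hT, if_neg]
    rintro ⟨rfl, rfl⟩
    exact hab hkj.le
  · intro a b hab
    rw [hU, if_neg]
    rintro ⟨rfl | rfl, rfl⟩
    exacts [hab hik.le, hab his.le]
  · have left_eq : vprod T (vprod U Uᵀ) j s = 0 := by
      have hks_entry : vprod U Uᵀ k s = 0 := if_neg (by tauto)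
      simp [vprod.eq_def T, hT, hks_entry]
    have right_eq : vprod (vprod T U) Uᵀ j s = 1 := by
      have hji_entry : vprod T U j i = 1 := by
        rw [vprod, if_pos (Or.inr (Or.inr (hik.trans hkj).le)), Finset.sum_eq_single k]
        · simp [hT, hU]
        · intro b _ hb
          simp [hT, hb]
        · simp
      simp [vprod.eq_def (vprod T U), hU, hji_entry, hsj.le]
    rw [h, right_eq] at left_eq
    exact one_ne_zero left_eq
end

section
/- Let I be a finite poset. Then the truncated (Vinberg) product T∘Tᵀ coincides with the ordinary matrix product T·Tᵀ for every T ∈ 𝒯_l⁺ if and only if I has no source. -/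
open Matrix
open scoped Classical

/-- `𝒯_l⁺` : lower triangular matrices with strictly positive diagonal entries. -/
def IsTlPos {I : Type*} [Fintype I] [PartialOrder I] (A : Matrix I I ℝ) : Prop :=
  IsTl A ∧ ∀ i, 0 < A i i

/-- A source of a poset `I` is an element `k` such that there exist incomparable
`i, j` with `k ≺ i` and `k ≺ j`. -/
def HasSource (I : Type*) [PartialOrder I] : Prop :=
  ∃ k i j : I, ¬ i ≤ j ∧ ¬ j ≤ i ∧ k < i ∧ k < j

/-- The zeta matrix of a finite poset, with entry `1` at `(j, k)` when `k ≤ j`, lies in `𝒯_l⁺`. -/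
lemma isTlPos_zeta (I : Type*) [Fintype I] [PartialOrder I] :
    IsTlPos (Matrix.of fun j k : I => if k ≤ j then (1 : ℝ) else 0) :=
  ⟨fun _ _ h => if_neg h, fun i => by simp⟩

/-- In a poset without a source, elements with a common lower bound are comparable. -/
lemma le_or_le_of_not_hasSource {I : Type*} [PartialOrder I] (h : ¬ HasSource I) {i j k : I}
    (hi : k ≤ i) (hj : k ≤ j) : i ≤ j ∨ j ≤ i := by
  by_contra! hc
  refine h ⟨k, i, j, hc.1, hc.2, hi.lt_of_ne ?_, hj.lt_of_ne ?_⟩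
  · rintro rfl
    exact hc.1 hj
  · rintro rfl
    exact hc.2 hi

/-- The truncated product `T ∘ Tᵀ` coincides with the ordinary matrix product
`T · Tᵀ` for every `T ∈ 𝒯_l⁺` if and only if `I` has no source. -/
theorem vprod_eq_mul_iff_no_source (I : Type*) [Fintype I] [PartialOrder I] :
    (∀ T : Matrix I I ℝ, IsTlPos T → vprod T Tᵀ = T * Tᵀ) ↔ ¬ HasSource I := by
  constructor
  · rintro h ⟨k, i, j, hij, hji, hki, hkj⟩
    have hsum := congrFun (congrFun (h _ (isTlPos_zeta I)) i) j
    have hne : i ≠ j := fun e => hij e.le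
    simp only [vprod, hne, hij, hji, or_self, if_false, Matrix.mul_apply,
      Matrix.transpose_apply, Matrix.of_apply] at hsum
    have hzero := (Finset.sum_eq_zero_iff_of_nonneg
      (fun μ _ => by positivity)).mp hsum.symm k (Finset.mem_univ k)
    simp [hki.le, hkj.le] at hzero
  · intro h T hT
    ext i j
    simp only [vprod, Matrix.mul_apply, Matrix.transpose_apply]
    split_ifs with hc
    · rfl
    · refine (Finset.sum_eq_zero fun μ _ => ?_).symm
      by_cases hi : μ ≤ i
      · by_cases hj : μ ≤ j
        · exact absurd (Or.inr (le_or_le_of_not_hasSource h hi hj)) hc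
        · rw [hT.1 j μ hj, mul_zero]
      · rw [hT.1 i μ hi, zero_mul]
end

section
/- Let I be a finite poset satisfying condition (F) and let m be a maximal element of I (no element of I is strictly greater than m). Then the subposet I_{⪯m} = {i ∈ I : i ⪯ m}, with the induced order, has no source. -/
open SimpleGraph

/-- Condition (F): for any two comparable distinct elements `i, j` of the poset,
the path between `i` and `j` in the Hasse diagram of `I` is unique. -/
def ConditionF (I : Type*) [PartialOrder I] : Prop :=
  ∀ i j : I, (i < j ∨ j < i) → ∀ p q : (SimpleGraph.hasse I).Path i j, p = q

theorem exists_hasse_walk_support_pairwise_lt {α : Type*} [PartialOrder α] [LocallyFiniteOrder α]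
    {a b : α} (hab : a ≤ b) :
    ∃ p : (hasse α).Walk a b,
      p.support.Pairwise (· < ·) ∧ ∀ x ∈ p.support, a ≤ x ∧ x ≤ b := by
  induction le_iff_reflTransGen_covBy.1 hab using Relation.ReflTransGen.head_induction_on with
  | refl => exact ⟨.nil, by simp, by simp⟩
  | @head a c hac hcb ih =>
    have hcb : c ≤ b := le_iff_reflTransGen_covBy.2 hcb
    obtain ⟨p, hp, hpx⟩ := ih hcb
    refine ⟨.cons (hasse_adj.2 (.inl hac)) p, ?_, ?_⟩
    · rw [Walk.support_cons, List.pairwise_cons]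
      exact ⟨fun x hx => hac.lt.trans_le (hpx x hx).1, hp⟩
    · intro x hx
      rw [Walk.support_cons, List.mem_cons] at hx
      rcases hx with rfl | hx
      · exact ⟨le_rfl, hab⟩
      · exact ⟨hac.le.trans (hpx x hx).1, (hpx x hx).2⟩

theorem exists_hasse_path_through {α : Type*} [PartialOrder α] [LocallyFiniteOrder α]
    {a b c : α} (hab : a ≤ b) (hbc : b ≤ c) :
    ∃ p : (hasse α).Path a c, p.1.support.Pairwise (· < ·) ∧ b ∈ p.1.support := by
  obtain ⟨p, hp, hpx⟩ := exists_hasse_walk_support_pairwise_lt hab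
  obtain ⟨q, hq, -⟩ := exists_hasse_walk_support_pairwise_lt hbc
  rw [← Walk.cons_tail_support, List.pairwise_cons] at hq
  have hpq : (p.append q).support.Pairwise (· < ·) := by
    rw [Walk.support_append, List.pairwise_append]
    exact ⟨hp, hq.2, fun x hx y hy => (hpx x hx).2.trans_lt (hq.1 y hy)⟩
  refine ⟨⟨p.append q, ?_⟩, hpq, ?_⟩
  · rw [Walk.isPath_def]
    exact hpq.imp ne_of_lt
  · exact (Walk.mem_support_append_iff _ _).2 (Or.inl p.end_mem_support)

/-- If `I` is a finite poset satisfying condition (F) and `m` is a maximal element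
of `I`, then the subposet `{i ∈ I : i ⪯ m}`, with the induced order, has no source. -/
theorem no_source_below_maximal {I : Type*} [Fintype I] [PartialOrder I]
    (hF : ConditionF I) (m : I) (hm : ∀ i : I, ¬ m < i) :
    ¬ HasSource {i : I // i ≤ m} := by
  classical
  let _ : LocallyFiniteOrder I := Fintype.toLocallyFiniteOrder
  rintro ⟨k, i, j, hij, hji, hki, hkj⟩
  obtain ⟨p, hp, hip⟩ := exists_hasse_path_through (Subtype.coe_le_coe.2 hki.le) i.2
  obtain ⟨q, -, hjq⟩ := exists_hasse_path_through (Subtype.coe_le_coe.2 hkj.le) j.2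
  obtain rfl := hF k m (.inl ((Subtype.coe_lt_coe.2 hki).trans_le i.2)) p q
  have hcomp : p.1.support.Pairwise fun x y => x ≤ y ∨ y ≤ x := hp.imp fun h => .inl h.le
  have : Std.Symm fun x y : I => x ≤ y ∨ y ≤ x := ⟨fun _ _ => Or.symm⟩
  exact (hcomp.forall_of_forall (fun x _ => .inl le_rfl) hip hjq).elim hij hji
end

section
/- Let I be a finite poset, T ∈ 𝒯_l⁺ and Z = T·Tᵀ (ordinary matrix product). For every v ∈ I, det(Z_{⪯v}) = ∏_{i⪯v} (T_{ii})², where Z_{⪯v} denotes the principal submatrix of Z indexed by {i ∈ I : i ⪯ v}; consequently, with Z_{≺v} the principal submatrix indexed by {i ∈ I : i ≺ v} (the determinant of the empty matrix being 1), det(Z_{⪯v})/det(Z_{≺v}) = (T_{vv})² = Z_{[v]·}. -/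
open Matrix
open scoped Classical

/-- The determinant of a matrix that is lower triangular with respect to a partial order is the
product of its diagonal entries. -/
theorem det_eq_prod_diag_of_isTl {I : Type*} [Fintype I] [DecidableEq I] [PartialOrder I]
    {A : Matrix I I ℝ} (hA : IsTl A) : A.det = ∏ i, A i i := by
  let e : LinearExtension I ≃ I := Equiv.refl I
  let _ : Fintype (LinearExtension I) := Fintype.ofEquiv I e.symm
  rw [← det_submatrix_equiv_self e A, det_of_isLowerTriangular]
  · exact e.prod_comp fun i => A i i
  · intro i j hij
    refine hA _ _ fun hle => ?_
    exact absurd (toLinearExtension.monotone hle) (not_le_of_gt (OrderDual.toDual_lt_toDual.mp hij))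

/-- The principal submatrix of `T * Tᵀ` on a lower set factors through that of `T`. -/
theorem IsTl.submatrix_mul_transpose {I : Type*} [Fintype I] [PartialOrder I]
    {T : Matrix I I ℝ} (hT : IsTl T) {p : I → Prop} [Fintype {i // p i}]
    (hp : ∀ i j, j ≤ i → p i → p j) :
    (T * Tᵀ).submatrix (fun i : {i // p i} => (i : I)) (fun i : {i // p i} => (i : I)) =
      T.submatrix (fun i : {i // p i} => (i : I)) (fun i : {i // p i} => (i : I)) *
        (T.submatrix (fun i : {i // p i} => (i : I)) (fun i : {i // p i} => (i : I)))ᵀ := by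
  ext i j
  simp only [submatrix_apply, mul_apply, transpose_apply]
  symm
  refine Finset.sum_of_injOn Subtype.val Subtype.val_injective.injOn (by simp) ?_ (by simp)
  intro k _ hk
  have hpk : ¬ p k := fun h => hk ⟨⟨k, h⟩, by simp, rfl⟩
  rw [hT i k fun hle => hpk (hp _ _ hle i.2), zero_mul]

/-- The determinant of the principal submatrix of `T * Tᵀ` on a lower set. -/
theorem IsTl.det_submatrix_mul_transpose {I : Type*} [Fintype I] [PartialOrder I]
    {T : Matrix I I ℝ} (hT : IsTl T) {p : I → Prop} [Fintype {i // p i}]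
    [DecidableEq {i // p i}] (hp : ∀ i j, j ≤ i → p i → p j) :
    ((T * Tᵀ).submatrix (fun i : {i // p i} => (i : I)) (fun i : {i // p i} => (i : I))).det =
      ∏ i : {i // p i}, T i i ^ 2 := by
  have hsub : IsTl (T.submatrix (fun i : {i // p i} => (i : I)) (fun i : {i // p i} => (i : I))) :=
    fun j k hjk => hT j k hjk
  rw [hT.submatrix_mul_transpose hp, det_mul, det_transpose, det_eq_prod_diag_of_isTl hsub, ← sq,
    ← Finset.prod_pow]
  rfl

/-- For `T ∈ 𝒯_l⁺` and `Z = T·Tᵀ`, the determinant of the principal submatrix of `Z`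
indexed by `{i : i ⪯ v}` equals `∏_{i⪯v} (T_{ii})²`, and the ratio
`det(Z_{⪯v})/det(Z_{≺v})` equals `(T_{vv})² = Z_{[v]·}`. -/
theorem det_principal_submatrix {I : Type*} [Fintype I] [DecidableEq I] [PartialOrder I]
    (T : Matrix I I ℝ) (hT : IsTlPos T) (v : I) :
    ((T * Tᵀ).submatrix (fun i : {i : I // i ≤ v} => (i : I))
        (fun i : {i : I // i ≤ v} => (i : I))).det
      = ∏ i : {i : I // i ≤ v}, (T (i : I) (i : I)) ^ 2 ∧
    ((T * Tᵀ).submatrix (fun i : {i : I // i ≤ v} => (i : I))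
        (fun i : {i : I // i ≤ v} => (i : I))).det /
      ((T * Tᵀ).submatrix (fun i : {i : I // i < v} => (i : I))
        (fun i : {i : I // i < v} => (i : I))).det
      = (T v v) ^ 2 := by
  have hle := hT.1.det_submatrix_mul_transpose (p := (· ≤ v)) fun _ _ => le_trans
  have hlt := hT.1.det_submatrix_mul_transpose (p := (· < v)) fun _ _ => lt_of_le_of_lt
  refine ⟨hle, ?_⟩
  have hpos : 0 < ∏ i : {i : I // i < v}, T i i ^ 2 :=
    Finset.prod_pos fun i _ => pow_pos (hT.2 i) 2
  rw [hle, hlt, div_eq_iff hpos.ne',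
    ← Finset.prod_subtype (Finset.univ.filter (· ≤ v)) (by simp) fun i => T i i ^ 2,
    ← Finset.prod_subtype (Finset.univ.filter (· < v)) (by simp) fun i => T i i ^ 2]
  have hins : Finset.univ.filter (· ≤ v) = insert v (Finset.univ.filter (· < v)) := by
    ext i
    simp [le_iff_eq_or_lt]
  rw [hins, Finset.prod_insert (by simp)]
end

section
/- Let I be a finite poset, A ∈ 𝒯_l⁺ and σ ∈ 𝒫. Then A·σ·Aᵀ ∈ 𝒫 and, for every i ∈ I, (A·σ·Aᵀ)_{[i]·} = (A_{ii})²·σ_{[i]·} = (A·Aᵀ)_{[i]·}·σ_{[i]·}. -/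
open Matrix
open scoped Classical

/-- The homogeneous cone `𝒫 = {T·Tᵀ : T ∈ 𝒯_l⁺}`. -/
def Pset (I : Type*) [Fintype I] [PartialOrder I] : Set (Matrix I I ℝ) :=
  {S | ∃ T : Matrix I I ℝ, IsTlPos T ∧ S = T * Tᵀ}

/-- The (unique) Cholesky factor in `𝒯_l⁺` of an element of `𝒫`
(junk value `1` outside `𝒫`). -/
noncomputable def chol {I : Type*} [Fintype I] [PartialOrder I]
    (S : Matrix I I ℝ) : Matrix I I ℝ :=
  if h : ∃ T : Matrix I I ℝ, IsTlPos T ∧ S = T * Tᵀ then h.choose else 1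

/-- `S_{[i]·} = (T_{ii})²` where `S = T·Tᵀ` is the Cholesky factorization. -/
noncomputable def bracket {I : Type*} [Fintype I] [PartialOrder I]
    (S : Matrix I I ℝ) (i : I) : ℝ :=
  (chol S i i) ^ 2

theorem IsTlPos.mul_apply_self {I : Type*} [Fintype I] [PartialOrder I]
    {A B : Matrix I I ℝ} (hA : IsTlPos A) (hB : IsTlPos B) (i : I) :
    (A * B) i i = A i i * B i i := by
  rw [Matrix.mul_apply]
  refine Fintype.sum_eq_single i fun k hk => ?_
  by_cases h : k ≤ i
  · rw [hB.1 k i fun h' => hk (le_antisymm h h'), mul_zero]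
  · rw [hA.1 i k h, zero_mul]

theorem IsTlPos.mul {I : Type*} [Fintype I] [PartialOrder I]
    {A B : Matrix I I ℝ} (hA : IsTlPos A) (hB : IsTlPos B) : IsTlPos (A * B) := by
  refine ⟨fun j k hjk => ?_, fun i => ?_⟩
  · rw [Matrix.mul_apply]
    refine Finset.sum_eq_zero fun l _ => ?_
    by_cases h : l ≤ j
    · rw [hB.1 l k fun h' => hjk (h'.trans h), mul_zero]
    · rw [hA.1 j l h, zero_mul]
  · rw [hA.mul_apply_self hB]
    exact mul_pos (hA.2 i) (hB.2 i)

/-- Uniqueness of the Cholesky factorization with respect to a poset. -/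
theorem IsTlPos.eq_of_mul_transpose_eq {I : Type*} [Fintype I] [PartialOrder I]
    {T U : Matrix I I ℝ} (hT : IsTlPos T) (hU : IsTlPos U) (h : T * Tᵀ = U * Uᵀ) :
    T = U := by
  suffices hrow : ∀ i j, T i j = U i j from Matrix.ext hrow
  intro i
  induction i using WellFoundedLT.induction with
  | ind i ihi =>
  intro j
  induction j using WellFoundedLT.induction with
  | ind j ihj =>
  by_cases hji : j ≤ i
  · have hsum : ∑ k, T i k * T j k = ∑ k, U i k * U j k := by
      simpa [Matrix.mul_apply] using congrFun (congrFun h i) j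
    have hrest : ∑ k ∈ {j}ᶜ, T i k * T j k = ∑ k ∈ {j}ᶜ, U i k * U j k := by
      refine Finset.sum_congr rfl fun k hk => ?_
      have hkj : k ≠ j := by simpa using hk
      by_cases hle : k ≤ j
      · have hlt := lt_of_le_of_ne hle hkj
        rw [ihj k hlt]
        rcases hji.eq_or_lt with rfl | hlt'
        · rw [ihj k hlt]
        · rw [ihi j hlt' k]
      · rw [hT.1 j k hle, hU.1 j k hle, mul_zero, mul_zero]
    rw [Fintype.sum_eq_add_sum_compl j, Fintype.sum_eq_add_sum_compl j, hrest] at hsum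
    have hdiag : T i j * T j j = U i j * U j j := add_right_cancel hsum
    rcases hji.eq_or_lt with rfl | hlt
    · exact (mul_self_inj (hT.2 j).le (hU.2 j).le).1 hdiag
    · rw [ihi j hlt j] at hdiag
      exact mul_right_cancel₀ (hU.2 j).ne' hdiag
  · rw [hT.1 i j hji, hU.1 i j hji]

theorem IsTlPos.chol_mul_transpose {I : Type*} [Fintype I] [PartialOrder I]
    {T : Matrix I I ℝ} (hT : IsTlPos T) : chol (T * Tᵀ) = T := by
  have h : ∃ U : Matrix I I ℝ, IsTlPos U ∧ T * Tᵀ = U * Uᵀ := ⟨T, hT, rfl⟩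
  rw [chol, dif_pos h]
  exact (hT.eq_of_mul_transpose_eq h.choose_spec.1 h.choose_spec.2).symm

theorem IsTlPos.bracket_mul_transpose {I : Type*} [Fintype I] [PartialOrder I]
    {T : Matrix I I ℝ} (hT : IsTlPos T) (i : I) : bracket (T * Tᵀ) i = T i i ^ 2 := by
  rw [bracket, hT.chol_mul_transpose]

/-- For `A ∈ 𝒯_l⁺` and `σ ∈ 𝒫` one has `A·σ·Aᵀ ∈ 𝒫` and, for every `i`,
`(A·σ·Aᵀ)_{[i]·} = (A_{ii})²·σ_{[i]·} = (A·Aᵀ)_{[i]·}·σ_{[i]·}`. -/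
theorem conjugation_bracket {I : Type*} [Fintype I] [DecidableEq I] [PartialOrder I]
    (A : Matrix I I ℝ) (hA : IsTlPos A) (σ : Matrix I I ℝ) (hσ : σ ∈ Pset I) :
    A * σ * Aᵀ ∈ Pset I ∧
      ∀ i : I, bracket (A * σ * Aᵀ) i = (A i i) ^ 2 * bracket σ i ∧
        bracket (A * σ * Aᵀ) i = bracket (A * Aᵀ) i * bracket σ i := by
  obtain ⟨T, hT, rfl⟩ := hσ
  have hconj : A * (T * Tᵀ) * Aᵀ = (A * T) * (A * T)ᵀ := by
    simp only [Matrix.transpose_mul, Matrix.mul_assoc]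
  have hAT := hA.mul hT
  refine ⟨⟨A * T, hAT, hconj⟩, fun i => ?_⟩
  rw [hconj, hAT.bracket_mul_transpose, hT.bracket_mul_transpose, hA.bracket_mul_transpose,
    hA.mul_apply_self hT, mul_pow]
  exact ⟨rfl, rfl⟩
end
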